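/- Over 𝔽₂, the ring of PGL₂-invariants of 𝔽₂[A₁,B₁,C₁,A₂,B₂,C₂] is the 𝔽₂-subalgebra generated by B₁, B₂ and Λ, and B₁, B₂, Λ are algebraically independent over 𝔽₂; hence the invariant ring is a polynomial ring 𝔽₂[B₁,B₂,Λ]. -/

import Mathlib

open MvPolynomial

noncomputable section

/- Variables in `MvPolynomial (Fin 6) (ZMod 2)`: `0 = A₁, 1 = B₁, 2 = C₁, 3 = A₂, 4 = B₂, 5 = C₂`.
   Variables in `MvPolynomial (Fin 10) (ZMod 2)`: `0 = a, 1 = b, 2 = c, 3 = d`, then `A₁,…,C₂`. -/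

/-- The inclusion `𝔽₂[A₁,…,C₂] → 𝔽₂[a,b,c,d][A₁,…,C₂]`. -/
def emb : MvPolynomial (Fin 6) (ZMod 2) →ₐ[ZMod 2] MvPolynomial (Fin 10) (ZMod 2) :=
  aeval fun i => X ⟨i.val + 4, by omega⟩

def va : MvPolynomial (Fin 10) (ZMod 2) := X 0
def vb : MvPolynomial (Fin 10) (ZMod 2) := X 1
def vc : MvPolynomial (Fin 10) (ZMod 2) := X 2
def vd : MvPolynomial (Fin 10) (ZMod 2) := X 3
def wA1 : MvPolynomial (Fin 10) (ZMod 2) := X 4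
def wB1 : MvPolynomial (Fin 10) (ZMod 2) := X 5
def wC1 : MvPolynomial (Fin 10) (ZMod 2) := X 6
def wA2 : MvPolynomial (Fin 10) (ZMod 2) := X 7
def wB2 : MvPolynomial (Fin 10) (ZMod 2) := X 8
def wC2 : MvPolynomial (Fin 10) (ZMod 2) := X 9

/-- The coefficient-substitution homomorphism `σ` in characteristic `2`:
`Aᵢ ↦ Aᵢa² + Bᵢac + Cᵢc²`, `Bᵢ ↦ Bᵢ(ad+bc)`, `Cᵢ ↦ Aᵢb² + Bᵢbd + Cᵢd²`. -/
def σPGL : MvPolynomial (Fin 6) (ZMod 2) →ₐ[ZMod 2] MvPolynomial (Fin 10) (ZMod 2) :=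
  aeval ![wA1 * va ^ 2 + wB1 * va * vc + wC1 * vc ^ 2,
          wB1 * (va * vd + vb * vc),
          wA1 * vb ^ 2 + wB1 * vb * vd + wC1 * vd ^ 2,
          wA2 * va ^ 2 + wB2 * va * vc + wC2 * vc ^ 2,
          wB2 * (va * vd + vb * vc),
          wA2 * vb ^ 2 + wB2 * vb * vd + wC2 * vd ^ 2]

/-- `p` is a `PGL₂`-invariant: each homogeneous component of degree `n` satisfies
`σ(p) = (ad - bc)ⁿ · p`. -/
def IsPGLInvariant (p : MvPolynomial (Fin 6) (ZMod 2)) : Prop :=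
  ∀ n : ℕ, σPGL (homogeneousComponent n p) =
    (va * vd - vb * vc) ^ n * emb (homogeneousComponent n p)

def B₁ : MvPolynomial (Fin 6) (ZMod 2) := X 1
def B₂ : MvPolynomial (Fin 6) (ZMod 2) := X 4

/-- The reduction mod 2 of the integral invariant `Λ`. -/
def Λinv : MvPolynomial (Fin 6) (ZMod 2) :=
  (X 0 * X 5 + X 2 * X 3) ^ 2 + (X 0 * X 5 + X 2 * X 3) * (X 1 * X 4)
    + X 0 * X 2 * X 4 ^ 2 + X 3 * X 5 * X 1 ^ 2

theorem res_identity {R : Type*} [CommRing R] (h2 : (2 : R) = 0) (a b c d A B C D E F : R) :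
    ((A * a ^ 2 + B * a * c + C * c ^ 2) * (D * b ^ 2 + E * b * d + F * d ^ 2)
        + (A * b ^ 2 + B * b * d + C * d ^ 2) * (D * a ^ 2 + E * a * c + F * c ^ 2)) ^ 2
      + ((A * a ^ 2 + B * a * c + C * c ^ 2) * (D * b ^ 2 + E * b * d + F * d ^ 2)
        + (A * b ^ 2 + B * b * d + C * d ^ 2) * (D * a ^ 2 + E * a * c + F * c ^ 2))
        * (B * (a * d + b * c) * (E * (a * d + b * c)))
      + (A * a ^ 2 + B * a * c + C * c ^ 2) * (A * b ^ 2 + B * b * d + C * d ^ 2)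
        * (E * (a * d + b * c)) ^ 2
      + (D * a ^ 2 + E * a * c + F * c ^ 2) * (D * b ^ 2 + E * b * d + F * d ^ 2)
        * (B * (a * d + b * c)) ^ 2
    = (a * d + b * c) ^ 4 *
      ((A * F + C * D) ^ 2 + (A * F + C * D) * (B * E) + A * C * E ^ 2 + D * F * B ^ 2) := by
  linear_combination (
    2*c^4*d^4*C^2*F^2 + 2*b*c^4*d^3*C^2*E*F + 2*b*c^4*d^3*B*C*F^2 + 1*b^2*c^4*d^2*C^2*E^2
    + 2*b^2*c^4*d^2*C^2*D*F + 2*b^2*c^4*d^2*B*C*E*F + 1*b^2*c^4*d^2*B^2*F^2 +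
    2*b^2*c^4*d^2*A*C*F^2 + 1*b^3*c^4*d*C^2*D*E + 1*b^3*c^4*d*B*C*E^2 +
    1*b^3*c^4*d*B*C*D*F + 1*b^3*c^4*d*B^2*E*F + 1*b^3*c^4*d*A*C*E*F + 1*b^3*c^4*d*A*B*F^2
    + 2*a*c^3*d^4*C^2*E*F + 2*a*c^3*d^4*B*C*F^2 + 2*a*b*c^3*d^3*C^2*E^2 +
    8*a*b*c^3*d^3*B*C*E*F + 2*a*b*c^3*d^3*B^2*F^2 + 1*a*b^2*c^3*d^2*C^2*D*E +
    5*a*b^2*c^3*d^2*B*C*E^2 + 3*a*b^2*c^3*d^2*B*C*D*F + 5*a*b^2*c^3*d^2*B^2*E*F +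
    3*a*b^2*c^3*d^2*A*C*E*F + 1*a*b^2*c^3*d^2*A*B*F^2 - 2*a*b^3*c^3*d*C^2*D^2 +
    2*a*b^3*c^3*d*B*C*D*E + 2*a*b^3*c^3*d*B^2*E^2 - 4*a*b^3*c^3*d*A*C*D*F +
    2*a*b^3*c^3*d*A*B*E*F - 2*a*b^3*c^3*d*A^2*F^2 + 1*a*b^4*c^3*B*C*D^2 +
    1*a*b^4*c^3*B^2*D*E + 1*a*b^4*c^3*A*C*D*E + 1*a*b^4*c^3*A*B*E^2 + 1*a*b^4*c^3*A*B*D*F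
    + 1*a*b^4*c^3*A^2*E*F + 1*a^2*c^2*d^4*C^2*E^2 + 2*a^2*c^2*d^4*C^2*D*F +
    2*a^2*c^2*d^4*B*C*E*F + 1*a^2*c^2*d^4*B^2*F^2 + 2*a^2*c^2*d^4*A*C*F^2 +
    1*a^2*b*c^2*d^3*C^2*D*E + 5*a^2*b*c^2*d^3*B*C*E^2 + 3*a^2*b*c^2*d^3*B*C*D*F +
    5*a^2*b*c^2*d^3*B^2*E*F + 3*a^2*b*c^2*d^3*A*C*E*F + 1*a^2*b*c^2*d^3*A*B*F^2 -
    2*a^2*b^2*c^2*d^2*C^2*D^2 + 6*a^2*b^2*c^2*d^2*B^2*E^2 - 2*a^2*b^2*c^2*d^2*A^2*F^2 +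
    1*a^2*b^3*c^2*d*B*C*D^2 + 5*a^2*b^3*c^2*d*B^2*D*E + 3*a^2*b^3*c^2*d*A*C*D*E +
    5*a^2*b^3*c^2*d*A*B*E^2 + 3*a^2*b^3*c^2*d*A*B*D*F + 1*a^2*b^3*c^2*d*A^2*E*F +
    1*a^2*b^4*c^2*B^2*D^2 + 2*a^2*b^4*c^2*A*C*D^2 + 2*a^2*b^4*c^2*A*B*D*E +
    1*a^2*b^4*c^2*A^2*E^2 + 2*a^2*b^4*c^2*A^2*D*F + 1*a^3*c*d^4*C^2*D*E +
    1*a^3*c*d^4*B*C*E^2 + 1*a^3*c*d^4*B*C*D*F + 1*a^3*c*d^4*B^2*E*F + 1*a^3*c*d^4*A*C*E*F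
    + 1*a^3*c*d^4*A*B*F^2 - 2*a^3*b*c*d^3*C^2*D^2 + 2*a^3*b*c*d^3*B*C*D*E +
    2*a^3*b*c*d^3*B^2*E^2 - 4*a^3*b*c*d^3*A*C*D*F + 2*a^3*b*c*d^3*A*B*E*F -
    2*a^3*b*c*d^3*A^2*F^2 + 1*a^3*b^2*c*d^2*B*C*D^2 + 5*a^3*b^2*c*d^2*B^2*D*E +
    3*a^3*b^2*c*d^2*A*C*D*E + 5*a^3*b^2*c*d^2*A*B*E^2 + 3*a^3*b^2*c*d^2*A*B*D*F +
    1*a^3*b^2*c*d^2*A^2*E*F + 2*a^3*b^3*c*d*B^2*D^2 + 8*a^3*b^3*c*d*A*B*D*E +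
    2*a^3*b^3*c*d*A^2*E^2 + 2*a^3*b^4*c*A*B*D^2 + 2*a^3*b^4*c*A^2*D*E +
    1*a^4*b*d^3*B*C*D^2 + 1*a^4*b*d^3*B^2*D*E + 1*a^4*b*d^3*A*C*D*E + 1*a^4*b*d^3*A*B*E^2
    + 1*a^4*b*d^3*A*B*D*F + 1*a^4*b*d^3*A^2*E*F + 1*a^4*b^2*d^2*B^2*D^2 +
    2*a^4*b^2*d^2*A*C*D^2 + 2*a^4*b^2*d^2*A*B*D*E + 1*a^4*b^2*d^2*A^2*E^2 +
    2*a^4*b^2*d^2*A^2*D*F + 2*a^4*b^3*d*A*B*D^2 + 2*a^4*b^3*d*A^2*D*E + 2*a^4*b^4*A^2*D^2) * h2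

abbrev KK := AlgebraicClosure (ZMod 2)

theorem two_KK : (2 : KK) = 0 := by
  have := congrArg (algebraMap (ZMod 2) KK) (show (2 : ZMod 2) = 0 from rfl)
  rw [map_zero] at this
  rw [← this]
  exact (map_ofNat _ 2).symm

/-- Action on points. -/
def act (a b c d : KK) (v : Fin 6 → KK) : Fin 6 → KK :=
  ![v 0 * a ^ 2 + v 1 * a * c + v 2 * c ^ 2,
    v 1 * (a * d + b * c),
    v 0 * b ^ 2 + v 1 * b * d + v 2 * d ^ 2,
    v 3 * a ^ 2 + v 4 * a * c + v 5 * c ^ 2,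
    v 4 * (a * d + b * c),
    v 3 * b ^ 2 + v 4 * b * d + v 5 * d ^ 2]

def tauPGL : MvPolynomial (Fin 6) (ZMod 2) →ₐ[ZMod 2] MvPolynomial (Fin 10) (ZMod 2) :=
  aeval fun i => (va * vd - vb * vc) * emb (X i)

theorem tau_homog (n : ℕ) (p : MvPolynomial (Fin 6) (ZMod 2)) (hp : p.IsHomogeneous n) :
    tauPGL p = (va * vd - vb * vc) ^ n * emb p := by
  rw [p.as_sum, map_sum, map_sum, Finset.mul_sum]
  refine Finset.sum_congr rfl fun m hm => ?_
  have hd : m.degree = n := by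
    have := hp (mem_support_iff.mp hm)
    rwa [Finsupp.degree_eq_weight_one]
  rw [monomial_eq, Finsupp.prod]
  simp only [map_mul, map_prod, map_pow]
  have : ∀ i, tauPGL (X i) = (va * vd - vb * vc) * emb (X i) := fun i => by simp [tauPGL]
  simp only [this, mul_pow, Finset.prod_mul_distrib, Finset.prod_pow_eq_pow_sum]
  have h2 : ∑ i ∈ m.support, m i = n := by rw [← hd]; rfl
  rw [h2]
  have h3 : tauPGL (C (coeff m p)) = emb (C (coeff m p)) := by
    rw [← algebraMap_eq, AlgHom.commutes, AlgHom.commutes]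
  rw [h3]; ring

theorem inv_eq {p : MvPolynomial (Fin 6) (ZMod 2)} (h : IsPGLInvariant p) :
    σPGL p = tauPGL p := by
  rw [← sum_homogeneousComponent p, map_sum, map_sum]
  refine Finset.sum_congr rfl fun n _ => ?_
  rw [h n, tau_homog n _ (homogeneousComponent_isHomogeneous n p)]

theorem inv_point {p : MvPolynomial (Fin 6) (ZMod 2)} (h : σPGL p = tauPGL p)
    (a b c d : KK) (v : Fin 6 → KK) (hdet : a * d + b * c = 1) :
    aeval (act a b c d v) p = aeval v p := by
  set w : Fin 10 → KK := ![a, b, c, d, v 0, v 1, v 2, v 3, v 4, v 5] with hw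
  have h1 : (aeval w).comp σPGL = aeval (R := ZMod 2) (act a b c d v) := by
    ext i
    fin_cases i <;>
      simp [σPGL, act, w, va, vb, vc, vd, wA1, wB1, wC1, wA2, wB2, wC2]
  have h2 : (aeval w).comp tauPGL = aeval (R := ZMod 2) v := by
    have hdet' : a * d - b * c = 1 := by linear_combination hdet - b * c * two_KK
    ext i
    fin_cases i <;>
      simp [tauPGL, emb, w, va, vb, vc, vd, hdet']
  rw [← h1, ← h2, AlgHom.comp_apply, AlgHom.comp_apply, h]

def LL (v : Fin 6 → KK) : KK :=
  (v 0 * v 5 + v 2 * v 3) ^ 2 + (v 0 * v 5 + v 2 * v 3) * (v 1 * v 4)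
    + v 0 * v 2 * v 4 ^ 2 + v 3 * v 5 * v 1 ^ 2

theorem aeval_Λ (v : Fin 6 → KK) : aeval v Λinv = LL v := by
  simp [Λinv, LL]

theorem LL_act (a b c d : KK) (v : Fin 6 → KK) :
    LL (act a b c d v) = (a * d + b * c) ^ 4 * LL v := by
  have := res_identity two_KK a b c d (v 0) (v 1) (v 2) (v 3) (v 4) (v 5)
  simpa [LL, act] using this

theorem exists_quad (b c : KK) : ∃ x : KK, x ^ 2 + b * x + c = 0 := by
  obtain ⟨x, hx⟩ := IsAlgClosed.exists_root
    (Polynomial.X ^ 2 + Polynomial.C b * Polynomial.X + Polynomial.C c : Polynomial KK) (by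
      have : (Polynomial.X ^ 2 + Polynomial.C b * Polynomial.X + Polynomial.C c : Polynomial KK).degree = 2 := by
        compute_degree!
      rw [this]; decide)
  exact ⟨x, by simpa [Polynomial.IsRoot] using hx⟩

theorem exists_normal (v : Fin 6 → KK) (hA : v 0 ≠ 0) (hB : v 1 ≠ 0) (hL : LL v ≠ 0) :
    ∃ a b c d : KK, a * d + b * c = 1 ∧
      act a b c d v = ![0, v 1, 0, 1, v 4, LL v / v 1 ^ 2] := by
  obtain ⟨r, hr⟩ := exists_quad (v 1 / v 0) (v 2 / v 0)
  have hr1 : v 0 * r ^ 2 + v 1 * r + v 2 = 0 := by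
    field_simp at hr
    linear_combination hr
  set s := r + v 1 / v 0 with hs
  have hs0 : v 0 * s = v 0 * r + v 1 := by rw [hs]; field_simp
  have hs1 : v 0 * s ^ 2 + v 1 * s + v 2 = 0 := by
    linear_combination (s + r) * hs0 + hr1 + (v 1 * s) * two_KK
  have hrs : r + s = v 1 / v 0 := by linear_combination hs + r * two_KK
  have hrs0 : r + s ≠ 0 := by rw [hrs]; exact div_ne_zero hB hA
  have key := LL_act r s 1 1 v
  have hf : v 3 * r ^ 2 + v 4 * r + v 5 ≠ 0 := by
    intro h0
    have : LL (act r s 1 1 v) = 0 := by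
      simp [LL, act, hr1, hs1, h0]
    rw [this] at key
    have : (r * 1 + s * 1) ^ 4 * LL v ≠ 0 := by
      refine mul_ne_zero (pow_ne_zero _ ?_) hL
      simpa using hrs0
    exact this key.symm
  obtain ⟨l, hl⟩ := exists_quad 0 (-(1 / (v 3 * r ^ 2 + v 4 * r + v 5)))
  have hl2 : l ^ 2 * (v 3 * r ^ 2 + v 4 * r + v 5) = 1 := by
    have : l ^ 2 = 1 / (v 3 * r ^ 2 + v 4 * r + v 5) := by linear_combination hl
    rw [this, one_div, inv_mul_cancel₀ hf]
  have hl0 : l ≠ 0 := by rintro rfl; simp at hl2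
  obtain ⟨m, hm⟩ : ∃ m, l * m * (r + s) = 1 := ⟨1 / (l * (r + s)), by field_simp⟩
  have hdet : (l * r) * m + (m * s) * l = 1 := by linear_combination hm
  refine ⟨l * r, m * s, l, m, hdet, ?_⟩
  have e0 : act (l * r) (m * s) l m v 0 = 0 := by
    simp [act]; linear_combination l ^ 2 * hr1
  have e1 : act (l * r) (m * s) l m v 1 = v 1 := by
    simp [act, hdet]
  have e2 : act (l * r) (m * s) l m v 2 = 0 := by
    simp [act]; linear_combination m ^ 2 * hs1
  have e3 : act (l * r) (m * s) l m v 3 = 1 := by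
    simp [act]; linear_combination hl2
  have e4 : act (l * r) (m * s) l m v 4 = v 4 := by
    simp [act, hdet]
  have key2 := LL_act (l * r) (m * s) l m v
  rw [hdet, LL, e0, e1, e2, e3, e4] at key2
  have e5 : act (l * r) (m * s) l m v 5 = LL v / v 1 ^ 2 := by
    field_simp
    linear_combination key2
  ext i
  fin_cases i
  · exact e0
  · exact e1
  · exact e2
  · exact e3
  · exact e4
  · exact e5

theorem exists_clear (r : MvPolynomial (Fin 3) (ZMod 2)) :
    ∃ (N : ℕ) (Q : MvPolynomial (Fin 3) (ZMod 2)), ∀ x y z : KK, x ≠ 0 →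
      x ^ N * aeval ![x, y, z / x ^ 2] r = aeval ![x, y, z] Q := by
  induction r using MvPolynomial.induction_on with
  | C c => exact ⟨0, C c, fun x y z _ => by simp⟩
  | add p q hp hq =>
    obtain ⟨N, P, hP⟩ := hp
    obtain ⟨M, Q, hQ⟩ := hq
    refine ⟨N + M, X 0 ^ M * P + X 0 ^ N * Q, fun x y z hx => ?_⟩
    simp only [map_add, map_mul, map_pow, aeval_X, ← hP x y z hx, ← hQ x y z hx]
    simp
    ring
  | mul_X p i hp =>
    obtain ⟨N, P, hP⟩ := hp
    fin_cases i
    · refine ⟨N, P * X 0, fun x y z hx => ?_⟩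
      simp only [map_mul, aeval_X, ← hP x y z hx]
      simp; ring
    · refine ⟨N, P * X 1, fun x y z hx => ?_⟩
      simp only [map_mul, aeval_X, ← hP x y z hx]
      simp; ring
    · refine ⟨N + 2, P * X 2, fun x y z hx => ?_⟩
      simp only [map_mul, aeval_X, ← hP x y z hx]
      simp; field_simp; ring

theorem eq_zero_of_points {n : ℕ} (p : MvPolynomial (Fin n) (ZMod 2))
    (h : ∀ v : Fin n → KK, aeval v p = 0) : p = 0 := by
  apply map_injective (algebraMap (ZMod 2) KK) (algebraMap (ZMod 2) KK).injective
  rw [map_zero]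
  have : Infinite KK := IsAlgClosed.instInfinite
  apply MvPolynomial.funext
  intro v
  rw [eval_map, map_zero]
  exact h v

theorem exists_point (x y z : KK) : ∃ v : Fin 6 → KK, v 1 = x ∧ v 4 = y ∧ LL v = z := by
  obtain ⟨w, hw⟩ := exists_quad (x * y) (-z)
  refine ⟨![1, x, 0, 0, y, w], rfl, rfl, ?_⟩
  simp [LL]
  linear_combination hw

theorem aeval_gen (Q : MvPolynomial (Fin 3) (ZMod 2)) (v : Fin 6 → KK) :
    aeval v (aeval ![B₁, B₂, Λinv] Q) = aeval ![v 1, v 4, LL v] Q := by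
  have : (aeval (R := ZMod 2) v).comp (aeval ![B₁, B₂, Λinv])
      = aeval (R := ZMod 2) ![v 1, v 4, LL v] := by
    ext i
    fin_cases i
    · simp [B₁]
    · simp [B₂]
    · simp [aeval_Λ]
  rw [← this, AlgHom.comp_apply]

theorem indep : AlgebraicIndependent (ZMod 2) ![B₁, B₂, Λinv] := by
  rw [algebraicIndependent_iff]
  intro Q hQ
  apply eq_zero_of_points
  intro u
  obtain ⟨v, h1, h4, hL⟩ := exists_point (u 0) (u 1) (u 2)
  have := aeval_gen Q v
  rw [hQ, map_zero, h1, h4, hL] at this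
  rw [this]
  congr 2
  ext i
  fin_cases i <;> rfl

theorem X_dvd_sub (Q : MvPolynomial (Fin 3) (ZMod 2)) :
    X 0 ∣ Q - aeval ![0, X 1, X 2] Q := by
  induction Q using MvPolynomial.induction_on with
  | C c => simp [algebraMap_eq]
  | add p q hp hq =>
    have := dvd_add hp hq
    rw [map_add]
    convert this using 1
    ring
  | mul_X p i hp =>
    rw [map_mul, aeval_X]
    fin_cases i
    · simp
    · have := hp.mul_right (X 1)
      convert this using 1
      simp; ring
    · have := hp.mul_right (X 2)
      convert this using 1
      simp; ring

theorem clear_B (M : ℕ) (p : MvPolynomial (Fin 6) (ZMod 2)) (Q : MvPolynomial (Fin 3) (ZMod 2))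
    (h : B₁ ^ M * p = aeval ![B₁, B₂, Λinv] Q) :
    ∃ Q' : MvPolynomial (Fin 3) (ZMod 2), p = aeval ![B₁, B₂, Λinv] Q' := by
  induction M generalizing Q with
  | zero => exact ⟨Q, by simpa using h⟩
  | succ M ih =>
    have h0 : aeval ![0, X 1, X 2] Q = (0 : MvPolynomial (Fin 3) (ZMod 2)) := by
      apply eq_zero_of_points
      intro u
      obtain ⟨v, h1, h4, hL⟩ := exists_point 0 (u 1) (u 2)
      have e := congrArg (aeval v) h
      rw [aeval_gen, h1, h4, hL, map_mul, map_pow] at e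
      have hB : aeval v B₁ = (0 : KK) := by simp [B₁, h1]
      rw [hB, zero_pow (Nat.succ_ne_zero M), zero_mul] at e
      have : (aeval (R := ZMod 2) u).comp (aeval ![0, X 1, X 2])
          = aeval (R := ZMod 2) ![0, u 1, u 2] := by
        ext i
        fin_cases i <;> simp
      rw [← AlgHom.comp_apply, this, ← e]
    have hd := X_dvd_sub Q
    rw [h0, sub_zero] at hd
    obtain ⟨Q1, rfl⟩ := hd
    apply ih Q1
    have hB : B₁ ≠ 0 := X_ne_zero _
    apply mul_left_cancel₀ hB
    rw [map_mul, aeval_X] at h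
    rw [← mul_assoc, ← pow_succ', h]
    rfl

theorem mem_of_inv {p : MvPolynomial (Fin 6) (ZMod 2)} (h : IsPGLInvariant p) :
    ∃ Q : MvPolynomial (Fin 3) (ZMod 2), p = aeval ![B₁, B₂, Λinv] Q := by
  have hst := inv_eq h
  obtain ⟨N, Q, hQ⟩ := exists_clear (aeval ![0, X 0, 0, 1, X 1, X 2] p)
  apply clear_B N p Q
  have hz : X 0 * X 1 * Λinv * (B₁ ^ N * p - aeval ![B₁, B₂, Λinv] Q) = 0 := by
    apply eq_zero_of_points
    intro v
    by_cases hA : v 0 = 0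
    · simp [hA]
    by_cases hB : v 1 = 0
    · simp [hB]
    by_cases hL : LL v = 0
    · simp [aeval_Λ, hL]
    obtain ⟨a, b, c, d, hdet, hact⟩ := exists_normal v hA hB hL
    have e := inv_point hst a b c d v hdet
    have e2 := hQ (v 1) (v 4) (LL v) hB
    have : (aeval (R := ZMod 2) ![v 1, v 4, LL v / v 1 ^ 2]).comp
        (aeval ![0, X 0, 0, 1, X 1, X 2])
          = aeval (R := ZMod 2) ![0, v 1, 0, 1, v 4, LL v / v 1 ^ 2] := by
      ext i
      fin_cases i <;> simp
    rw [← AlgHom.comp_apply, this, ← hact, e] at e2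
    rw [map_mul, map_sub, aeval_gen, ← e2]
    simp [B₁]
  have hΛ : Λinv ≠ 0 := indep.ne_zero 2
  have hne : X 0 * X 1 * Λinv ≠ 0 := mul_ne_zero (mul_ne_zero (X_ne_zero _) (X_ne_zero _)) hΛ
  exact sub_eq_zero.mp ((mul_eq_zero.mp hz).resolve_left hne)

theorem two_P : (2 : MvPolynomial (Fin 10) (ZMod 2)) = 0 := by
  have := congrArg (C (σ := Fin 10)) (show (2 : ZMod 2) = 0 from rfl)
  rw [map_zero] at this
  rw [← this]
  exact (map_ofNat _ 2).symm

theorem Λ_homog : Λinv.IsHomogeneous 4 := by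
  have hX := fun i : Fin 6 => isHomogeneous_X (ZMod 2) i
  have h1 : (X 0 * X 5 + X 2 * X 3 : MvPolynomial (Fin 6) (ZMod 2)).IsHomogeneous 2 :=
    ((hX 0).mul (hX 5)).add ((hX 2).mul (hX 3))
  exact (((h1.pow 2).add (h1.mul ((hX 1).mul (hX 4)))).add
    (((hX 0).mul (hX 2)).mul ((hX 4).pow 2))).add (((hX 3).mul (hX 5)).mul ((hX 1).pow 2))

theorem sigma_Λ : σPGL Λinv = tauPGL Λinv := by
  rw [tau_homog 4 _ Λ_homog]
  have h := res_identity two_P va vb vc vd wA1 wB1 wC1 wA2 wB2 wC2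
  have hd : va * vd - vb * vc = va * vd + vb * vc := by
    linear_combination (-vb * vc) * two_P
  have he : emb Λinv = (wA1 * wC2 + wC1 * wA2) ^ 2 + (wA1 * wC2 + wC1 * wA2) * (wB1 * wB2)
      + wA1 * wC1 * wB2 ^ 2 + wA2 * wC2 * wB1 ^ 2 := by
    simp [emb, Λinv, wA1, wB1, wC1, wA2, wB2, wC2]
  rw [hd, he, ← h]
  simp [σPGL, Λinv]

theorem closure_inv (x : MvPolynomial (Fin 6) (ZMod 2))
    (hx : x ∈ Submonoid.closure ({B₁, B₂, Λinv} : Set (MvPolynomial (Fin 6) (ZMod 2)))) :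
    ∃ n, x.IsHomogeneous n ∧ σPGL x = tauPGL x := by
  induction hx using Submonoid.closure_induction with
  | mem x hx =>
    rcases hx with rfl | rfl | rfl
    · refine ⟨1, isHomogeneous_X _ _, ?_⟩
      simp [B₁, σPGL, tauPGL, emb, wB1]
      linear_combination (X 5 * vb * vc) * two_P
    · refine ⟨1, isHomogeneous_X _ _, ?_⟩
      simp [B₂, σPGL, tauPGL, emb, wB2]
      linear_combination (X 8 * vb * vc) * two_P
    · exact ⟨4, Λ_homog, sigma_Λ⟩
  | one => exact ⟨0, isHomogeneous_one _ _, by simp⟩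
  | mul x y _ _ hx hy =>
    obtain ⟨n, hn, ex⟩ := hx
    obtain ⟨m, hm, ey⟩ := hy
    exact ⟨n + m, hn.mul hm, by rw [map_mul, map_mul, ex, ey]⟩

theorem inv_of_mem {p : MvPolynomial (Fin 6) (ZMod 2)}
    (h : p ∈ Algebra.adjoin (ZMod 2) ({B₁, B₂, Λinv} : Set (MvPolynomial (Fin 6) (ZMod 2)))) :
    IsPGLInvariant p := by
  rw [← Subalgebra.mem_toSubmodule, Algebra.adjoin_eq_span] at h
  induction h using Submodule.span_induction with
  | mem x hx =>
    obtain ⟨n, hn, ex⟩ := closure_inv x hx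
    intro m
    rw [homogeneousComponent_of_mem hn]
    split_ifs with hm
    · subst hm
      rw [ex, tau_homog _ _ hn]
    · simp
  | zero => intro n; simp
  | add x y _ _ hx hy =>
    intro n
    rw [map_add, map_add, map_add, hx n, hy n]; ring
  | smul c x _ hx =>
    intro n
    rw [map_smul, map_smul, map_smul, hx n, mul_smul_comm]

theorem pgl2_invariants_over_F2 :
    (∀ p : MvPolynomial (Fin 6) (ZMod 2),
      IsPGLInvariant p ↔
        p ∈ Algebra.adjoin (ZMod 2) ({B₁, B₂, Λinv} : Set (MvPolynomial (Fin 6) (ZMod 2)))) ∧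
    AlgebraicIndependent (ZMod 2) ![B₁, B₂, Λinv] := by
  refine ⟨fun p => ⟨fun h => ?_, inv_of_mem⟩, indep⟩
  obtain ⟨Q, rfl⟩ := mem_of_inv h
  have hr : ({B₁, B₂, Λinv} : Set (MvPolynomial (Fin 6) (ZMod 2)))
      = Set.range ![B₁, B₂, Λinv] := by
    ext x
    simp
    tauto
  rw [hr, Algebra.adjoin_range_eq_range_aeval]
  exact ⟨Q, rfl⟩
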